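/- arXiv:2508.10443 — 2 statements merged into one kernel-verified Lean document; each statement's English description precedes it below -/
import Mathlib

section
/- If T is a tree on n vertices with localization number ζ(T) = 2, then lcapt(T) ≤ ⌊n/2⌋ − 3. -/
/-- The closed neighborhood `N[S]` of a set `S` of vertices. -/
def closedNbhd {V : Type*} (G : SimpleGraph V) (S : Set V) : Set V :=
  {v | v ∈ S ∨ ∃ s ∈ S, G.Adj s v}

/-- `capt G k t S`: the candidate-set relation of the localization game with `k` cops:
`capt G k 1 S` holds iff there is a set `P` of at most `k` vertices whose distance
vector map is injective on `S`, and `capt G k (t+1) S` holds iff there is such a `P`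
for which every fiber `C` of the distance vector map on `S` is a singleton or
satisfies `capt G k t N[C]`.  (`capt G k 0 S` is `False`.) -/
def capt {V : Type*} (G : SimpleGraph V) (k : ℕ) : ℕ → Set V → Prop
  | 0, _ => False
  | t + 1, S => ∃ P : Finset V, P.card ≤ k ∧ ∀ v ∈ S,
      {u ∈ S | ∀ p ∈ P, G.dist u p = G.dist v p}.Subsingleton ∨
        capt G k t (closedNbhd G {u ∈ S | ∀ p ∈ P, G.dist u p = G.dist v p})

/-- The `k`-localization capture time: the least `t` such that `capt G k t V(G)` holds. -/
noncomputable def lcaptK {V : Type*} (G : SimpleGraph V) (k : ℕ) : ℕ :=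
  sInf {t | capt G k t Set.univ}

/-- The localization number: the least `k` for which some `t` with `capt G k t V(G)` exists. -/
noncomputable def zeta {V : Type*} (G : SimpleGraph V) : ℕ :=
  sInf {k | ∃ t, capt G k t Set.univ}

/-- The localization capture time `lcapt G = lcapt_{ζ(G)}(G)`. -/
noncomputable def lcapt {V : Type*} (G : SimpleGraph V) : ℕ := lcaptK G (zeta G)

/-- The number of leaves (vertices of degree 1) of a graph. -/
noncomputable def numLeaves {V : Type*} (G : SimpleGraph V) : ℕ :=
  {v : V | (G.neighborSet v).ncard = 1}.ncard

/-- The tree `T_{3,3}`: a root (vertex 0) with three children (1,2,3), each of which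
has exactly two children (4,5 ; 6,7 ; 8,9). -/
def T33 : SimpleGraph (Fin 10) :=
  SimpleGraph.fromEdgeSet
    {s(0, 1), s(0, 2), s(0, 3), s(1, 4), s(1, 5), s(2, 6), s(2, 7), s(3, 8), s(3, 9)}

/-- `G` contains a copy of `T_{3,3}`, i.e. a subgraph isomorphic to `T_{3,3}`. -/
def ContainsCopyT33 {V : Type*} (G : SimpleGraph V) : Prop :=
  ∃ f : Fin 10 → V, Function.Injective f ∧ ∀ a b : Fin 10, T33.Adj a b → G.Adj (f a) (f b)

namespace LocGame

variable {V : Type*} {T : SimpleGraph V}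

/-! ### Branches of a tree -/

/-- The vertices closer to `v` than to `u`: for an edge `uv` of a tree, the component of `v`
after deleting the edge. -/
def branch (T : SimpleGraph V) (u v : V) : Set V := {x | T.dist x u = T.dist x v + 1}

lemma dist_adj_le (hT : T.IsTree) {u v : V} (h : T.Adj u v) (x : V) :
    T.dist x u ≤ T.dist x v + 1 ∧ T.dist x v ≤ T.dist x u + 1 := by
  have := hT.dist_eq_dist_add_one_of_adj x h
  omega

lemma dist_adj_le' (hT : T.IsTree) {u v : V} (h : T.Adj u v) (x : V) :
    T.dist u x ≤ T.dist v x + 1 ∧ T.dist v x ≤ T.dist u x + 1 := by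
  have := dist_adj_le hT h x
  rwa [T.dist_comm (u := x), T.dist_comm (u := x)] at this

lemma dist_eq_zero (hT : T.IsTree) {u v : V} (h : T.dist u v = 0) : u = v :=
  (hT.connected.dist_eq_zero_iff).1 h

lemma dist_adj {u v : V} (h : T.Adj u v) : T.dist u v = 1 := SimpleGraph.dist_eq_one_iff_adj.2 h

lemma not_mem_branch (hT : T.IsTree) {u v x : V} (h : T.Adj u v) :
    x ∉ branch T u v ↔ x ∈ branch T v u := by
  have := hT.dist_eq_dist_add_one_of_adj x h
  simp only [branch, Set.mem_ofPred_eq]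
  omega

/-- Every vertex other than `v` has a neighbor of `v` closer to it. -/
lemma exists_branch (hT : T.IsTree) {v x : V} (h : x ≠ v) : ∃ c, T.Adj v c ∧ x ∈ branch T v c := by
  obtain ⟨p, hp⟩ := hT.connected.exists_walk_length_eq_dist v x
  cases p with
  | nil => exact absurd rfl h
  | @cons _ c _ hc q =>
    refine ⟨c, hc, ?_⟩
    have h1 := T.dist_le q
    have h2 := dist_adj_le hT hc x
    simp only [SimpleGraph.Walk.length_cons] at hp
    simp only [branch, Set.mem_ofPred_eq]
    rw [T.dist_comm (v := c)] at *
    rw [T.dist_comm (v := v)] at *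
    omega

lemma closer_unique (hT : T.IsTree) {s x v w : V} (hv : T.Adj x v) (hw : T.Adj x w)
    (h1 : s ∈ branch T x v) (h2 : s ∈ branch T x w) : v = w := by
  obtain ⟨p, hp⟩ := hT.connected.exists_walk_length_eq_dist s v
  obtain ⟨q, hq⟩ := hT.connected.exists_walk_length_eq_dist s w
  have hp' : (p.concat hv.symm).IsPath := SimpleGraph.Walk.isPath_of_length_eq_dist _ (by
    rw [SimpleGraph.Walk.length_concat, hp, h1])
  have hq' : (q.concat hw.symm).IsPath := SimpleGraph.Walk.isPath_of_length_eq_dist _ (by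
    rw [SimpleGraph.Walk.length_concat, hq, h2])
  have := (hT.existsUnique_path s x).unique hp' hq'
  have h3 := congrArg SimpleGraph.Walk.penultimate this
  simpa using h3

/-- The only edge leaving a branch is the edge defining it. -/
lemma branch_boundary (hT : T.IsTree) {u v s t : V} (h : T.Adj u v) (hst : T.Adj s t)
    (hs : s ∈ branch T u v) (ht : t ∉ branch T u v) : s = v ∧ t = u := by
  rw [not_mem_branch hT h] at ht
  have hs' : T.dist s u = T.dist s v + 1 := hs
  have ht' : T.dist t v = T.dist t u + 1 := ht
  have a1 := dist_adj_le' hT hst u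
  have a2 := dist_adj_le' hT hst v
  by_cases htu : t = u
  · subst htu
    have := dist_adj hst
    exact ⟨dist_eq_zero hT (by omega), rfl⟩
  · exfalso
    obtain ⟨c, hc, hc'⟩ := exists_branch hT htu
    have hc'' : T.dist t u = T.dist t c + 1 := hc'
    have a3 := dist_adj_le' hT hst c
    have a4 := dist_adj_le hT hc s
    have : v = c := closer_unique hT h hc hs (by simp only [branch, Set.mem_ofPred_eq]; omega)
    subst this
    omega

lemma dist_across (hT : T.IsTree) {u v x w : V} (h : T.Adj u v) (hx : x ∈ branch T u v)
    (hw : w ∉ branch T u v) : T.dist x w = T.dist x v + 1 + T.dist u w := by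
  have key : ∀ {a b : V} (p : T.Walk a b), a ∈ branch T u v → b ∉ branch T u v →
      T.dist a v + 1 + T.dist u b ≤ p.length := by
    intro a b p
    induction p with
    | nil => intro h1 h2; exact absurd h1 h2
    | @cons s t b hst q ih =>
      intro h1 h2
      rw [SimpleGraph.Walk.length_cons]
      by_cases ht : t ∈ branch T u v
      · have := ih ht h2
        have := dist_adj_le' hT hst v
        omega
      · obtain ⟨rfl, rfl⟩ := branch_boundary hT h hst h1 ht
        have := T.dist_le q
        simp only [SimpleGraph.dist_self]
        omega
  obtain ⟨p, hp⟩ := hT.connected.exists_walk_length_eq_dist x w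
  have h1 := key p hx hw
  have h2 := hT.connected.dist_triangle (u := x) (v := u) (w := w)
  have h3 : T.dist x u = T.dist x v + 1 := hx
  omega

lemma mem_branch_self {u v : V} (h : T.Adj u v) : v ∈ branch T u v := by
  simp [branch, dist_adj h.symm]

lemma not_mem_branch_left {u v : V} : u ∉ branch T u v := by
  simp [branch]

lemma mem_branch_of_adj (hT : T.IsTree) {u v w : V} (hw : T.Adj u w)
    (hm : w ∈ branch T u v) : w = v := by
  have : T.dist w u = T.dist w v + 1 := hm
  rw [dist_adj hw.symm] at this
  exact dist_eq_zero hT (by omega)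

lemma branch_subset (hT : T.IsTree) {u v w : V} (h : T.Adj u v) (hw : T.Adj v w) (hne : w ≠ u) :
    branch T v w ⊆ branch T u v := by
  intro x hx
  have hu : u ∉ branch T v w := fun hm => hne (mem_branch_of_adj hT h.symm hm).symm
  have h1 := dist_across hT hw hx hu
  have h2 : T.dist x v = T.dist x w + 1 := hx
  rw [dist_adj h.symm] at h1
  simp only [branch, Set.mem_ofPred_eq]
  omega

lemma branch_disjoint (hT : T.IsTree) {v c e x : V} (hc : T.Adj v c) (he : T.Adj v e)
    (hne : c ≠ e) (hx : x ∈ branch T v c) : x ∉ branch T v e :=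
  fun h => hne (closer_unique hT hc he hx h)

lemma mem_branch_iff (hT : T.IsTree) {u v x : V} (h : T.Adj u v) :
    x ∈ branch T u v ↔ x = v ∨ ∃ c, T.Adj v c ∧ c ≠ u ∧ x ∈ branch T v c := by
  constructor
  · intro hx
    by_cases hxv : x = v
    · exact Or.inl hxv
    · obtain ⟨c, hc, hc'⟩ := exists_branch hT hxv
      refine Or.inr ⟨c, hc, ?_, hc'⟩
      rintro rfl
      exact (not_mem_branch hT h).2 hc' hx
  · rintro (rfl | ⟨c, hc, hcu, hx⟩)
    · exact mem_branch_self h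
    · exact branch_subset hT h hc hcu hx

lemma branch_ncard_lt [Finite V] (hT : T.IsTree) {u v w : V} (h : T.Adj u v) (hw : T.Adj v w)
    (hne : w ≠ u) : (branch T v w).ncard < (branch T u v).ncard := by
  refine Set.ncard_lt_ncard ⟨branch_subset hT h hw hne, fun hsub => ?_⟩ (Set.toFinite _)
  exact not_mem_branch_left (hsub (mem_branch_self h))

/-! ### Closed neighborhoods and monotonicity -/

lemma closedNbhd_mono {S S' : Set V} (h : S ⊆ S') : closedNbhd T S ⊆ closedNbhd T S' := by
  rintro x (hx | ⟨s, hs, ha⟩)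
  · exact Or.inl (h hx)
  · exact Or.inr ⟨s, h hs, ha⟩

lemma capt_mono_set {k t : ℕ} : ∀ {S S' : Set V}, S ⊆ S' → capt T k t S' → capt T k t S := by
  induction t with
  | zero => intro S S' _ h; exact h
  | succ t ih =>
    rintro S S' hS ⟨P, hP, h⟩
    refine ⟨P, hP, fun v hv => ?_⟩
    have hsub : {u ∈ S | ∀ p ∈ P, T.dist u p = T.dist v p} ⊆
        {u ∈ S' | ∀ p ∈ P, T.dist u p = T.dist v p} := fun u hu => ⟨hS hu.1, hu.2⟩
    exact (h v (hS hv)).imp (fun h => h.anti hsub) (ih (closedNbhd_mono hsub))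

lemma capt_mono_time {k t t' : ℕ} (htt : t ≤ t') {S : Set V} (h : capt T k t S) :
    capt T k t' S := by
  have step : ∀ t (S : Set V), capt T k t S → capt T k (t + 1) S := by
    intro t
    induction t with
    | zero => intro S h; exact absurd h id
    | succ t ih =>
      rintro S ⟨P, hP, h⟩
      exact ⟨P, hP, fun v hv => (h v hv).imp id (ih _)⟩
  induction htt with
  | refl => exact h
  | step _ ih => exact step _ _ ih

/-! ### The game with one cop -/

/-- One cop wins from the candidate set `S`. -/
def Win (T : SimpleGraph V) (S : Set V) : Prop := ∃ t, capt T 1 t S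

/-- One cop wins after having learned that the robber was in `C` before his last move. -/
def Wins (T : SimpleGraph V) (C : Set V) : Prop := C.Subsingleton ∨ Win T (closedNbhd T C)

/-- The vertices of `S` at distance `l` from `v`. -/
def level (T : SimpleGraph V) (S : Set V) (v : V) (l : ℕ) : Set V := {x ∈ S | T.dist x v = l}

/-- One cop wins from every level of `A` around `v`. -/
def Good (T : SimpleGraph V) (v : V) (A : Set V) : Prop := ∀ l, Wins T (level T A v l)

/-- A vertex with at least three neighbors. -/
def Major (T : SimpleGraph V) (v : V) : Prop :=
  ∃ a b c, a ≠ b ∧ a ≠ c ∧ b ≠ c ∧ T.Adj v a ∧ T.Adj v b ∧ T.Adj v c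

lemma Win.mono {S S' : Set V} (h : S ⊆ S') : Win T S' → Win T S :=
  fun ⟨t, ht⟩ => ⟨t, capt_mono_set h ht⟩

lemma Wins.mono {S S' : Set V} (h : S ⊆ S') : Wins T S' → Wins T S :=
  Or.imp (fun h' => h'.anti h) (Win.mono (closedNbhd_mono h))

lemma level_mono {A B : Set V} (h : A ⊆ B) (v : V) (l : ℕ) : level T A v l ⊆ level T B v l :=
  fun _ hx => ⟨h hx.1, hx.2⟩

lemma Good.mono {v : V} {A B : Set V} (h : A ⊆ B) (hB : Good T v B) : Good T v A :=
  fun l => (hB l).mono (level_mono h v l)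

lemma level_zero_subsingleton (hT : T.IsTree) (A : Set V) (v : V) :
    (level T A v 0).Subsingleton := by
  intro x hx y hy
  rw [dist_eq_zero hT hx.2, dist_eq_zero hT hy.2]

lemma wins_of_closedNbhd_subset {C S : Set V} (h : closedNbhd T C ⊆ S) (hS : Win T S) :
    Wins T C := Or.inr (hS.mono h)

lemma win_of_probe [Finite V] {S : Set V} (p : V)
    (h : ∀ x ∈ S, Wins T {u ∈ S | T.dist u p = T.dist x p}) : Win T S := by
  have h' : ∀ x, ∃ t, x ∈ S → ({u ∈ S | T.dist u p = T.dist x p}.Subsingleton ∨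
      capt T 1 t (closedNbhd T {u ∈ S | T.dist u p = T.dist x p})) := by
    intro x
    by_cases hx : x ∈ S
    · rcases h x hx with h1 | ⟨t, ht⟩
      · exact ⟨0, fun _ => Or.inl h1⟩
      · exact ⟨t, fun _ => Or.inr ht⟩
    · exact ⟨0, fun hx' => absurd hx' hx⟩
  choose f hf using h'
  obtain ⟨M, hM⟩ := (Set.finite_range f).bddAbove
  refine ⟨M + 1, {p}, by simp, fun x hx => ?_⟩
  simp only [Finset.mem_singleton, forall_eq]
  exact (hf x hx).imp id (capt_mono_time (hM ⟨x, rfl⟩))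

lemma good_insert (hT : T.IsTree) {v : V} {A : Set V} (h : Good T v A) :
    Good T v (insert v A) := by
  intro l
  rcases Nat.eq_zero_or_pos l with rfl | hl
  · exact Or.inl (level_zero_subsingleton hT _ _)
  · refine (h l).mono ?_
    rintro x ⟨rfl | hx, hx'⟩
    · simp at hx'; omega
    · exact ⟨hx, hx'⟩

lemma closedNbhd_branch_subset (hT : T.IsTree) {u v : V} (h : T.Adj u v) {C : Set V}
    (hC : C ⊆ branch T u v) : closedNbhd T C ⊆ insert u (branch T u v) := by
  rintro x (hx | ⟨s, hs, ha⟩)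
  · exact Or.inr (hC hx)
  · by_cases hx : x ∈ branch T u v
    · exact Or.inr hx
    · exact Or.inl (branch_boundary hT h ha (hC hs) hx).2

lemma wins_of_subset_branch (hT : T.IsTree) {u v : V} (h : T.Adj u v)
    (hw : Win T (insert u (branch T u v))) {C : Set V} (hC : C ⊆ branch T u v) : Wins T C :=
  wins_of_closedNbhd_subset (closedNbhd_branch_subset hT h hC) hw

/-- Distances from `v` change by at most one under passing to the closed neighborhood. -/
lemma closedNbhd_dist (hT : T.IsTree) {C : Set V} {x : V} (hx : x ∈ closedNbhd T C) (v : V) :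
    ∃ s ∈ C, (x = s ∨ T.Adj s x) ∧
      T.dist x v ≤ T.dist s v + 1 ∧ T.dist s v ≤ T.dist x v + 1 := by
  rcases hx with hx | ⟨s, hs, ha⟩
  · exact ⟨x, hx, Or.inl rfl, by omega, by omega⟩
  · have := dist_adj_le' hT ha v
    exact ⟨s, hs, Or.inr ha, by omega, by omega⟩

/-- Probing into a branch at a vertex `e` of degree at most two tells the level of the robber
around `v` unless the robber is in that branch. -/
lemma wins_of_minor (hT : T.IsTree) [Finite V] {v e : V} (he : T.Adj v e) (hmin : ¬ Major T e)
    {C : Set V} {h : ℕ} (hpos : 1 ≤ h) (hge : ∀ x ∈ C, h ≤ T.dist x v)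
    (hin : ∀ x ∈ C, x ∈ branch T v e → T.dist x v = h)
    (hbr : h = 1 ∨ Win T (insert v (branch T v e)))
    (hout : ∀ l, Wins T (level T (closedNbhd T C \ branch T v e) v l)) : Wins T C := by
  right
  have hlow : ∀ u ∈ closedNbhd T C, h ≤ T.dist u v + 1 := by
    intro u hu
    obtain ⟨s, hs, -, h1, h2⟩ := closedNbhd_dist hT hu v
    have := hge s hs
    omega
  have hupp : ∀ u ∈ closedNbhd T C, u ∈ branch T v e → T.dist u v ≤ h + 1 := by
    intro u hu hub
    obtain ⟨s, hs, hsu, h1, h2⟩ := closedNbhd_dist hT hu v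
    by_cases hsb : s ∈ branch T v e
    · have := hin s hs hsb
      omega
    · rcases hsu with rfl | hsu
      · exact absurd hub hsb
      · obtain ⟨-, rfl⟩ := branch_boundary hT he hsu.symm hub hsb
        have := hge s hs
        simp at this
        omega
  by_cases hd : ∃ d, T.Adj e d ∧ d ≠ v
  · obtain ⟨d, hed, hdv⟩ := hd
    have hdb : d ∈ branch T v e := by
      by_contra hd'
      exact hdv (branch_boundary hT he hed (mem_branch_self he) hd').2
    have hinside : ∀ u ∈ branch T v e, u = e ∨ T.dist u v = T.dist u d + 2 := by
      intro u hu
      rcases (mem_branch_iff hT he).1 hu with h1 | ⟨c, hc, hcv, huc⟩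
      · exact Or.inl h1
      · have : c = d := by
          by_contra hcd
          exact hmin ⟨v, c, d, hcv.symm, hdv.symm, hcd, he.symm, hc, hed⟩
        subst this
        right
        have h1 : T.dist u e = T.dist u c + 1 := huc
        have h2 : T.dist u v = T.dist u e + 1 := hu
        omega
    have houtside : ∀ u, u ∉ branch T v e → T.dist u d = T.dist u v + 2 := by
      intro u hu
      have := dist_across hT he hdb hu
      rw [T.dist_comm (u := d) (v := u), T.dist_comm (u := v) (v := u), dist_adj hed.symm] at this
      omega
    have hede := dist_adj hed
    have hev := dist_adj he.symm
    refine win_of_probe d fun x hx => ?_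
    by_cases hxb : x ∈ branch T v e
    · have hsub : ∀ u ∈ closedNbhd T C, T.dist u d = T.dist x d → u ∈ branch T v e := by
        intro u hu hux
        by_contra hub
        have h1 := houtside u hub
        have h2 := hlow u hu
        have h3 := hupp x hx hxb
        rcases hinside x hxb with rfl | h4
        · omega
        · omega
      rcases hbr with rfl | hbr
      · left
        have key : ∀ u ∈ closedNbhd T C, u ∈ branch T v e →
            (u = e ∧ T.dist u d = 1) ∨ (u = d ∧ T.dist u d = 0) := by
          intro u hu hub
          rcases hinside u hub with rfl | h4
          · exact Or.inl ⟨rfl, hede⟩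
          · have := hupp u hu hub
            have h5 : T.dist u d = 0 := by omega
            exact Or.inr ⟨dist_eq_zero hT h5, h5⟩
        rintro u ⟨hu, hux⟩ w ⟨hw, hwx⟩
        rcases key u hu (hsub u hu hux) with ⟨h1, h2⟩ | ⟨h1, h2⟩ <;>
        rcases key w hw (hsub w hw hwx) with ⟨h3, h4⟩ | ⟨h3, h4⟩
        · rw [h1, h3]
        · omega
        · omega
        · rw [h1, h3]
      · exact wins_of_subset_branch hT he hbr fun u hu => hsub u hu.1 hu.2
    · refine (hout (T.dist x v)).mono ?_
      rintro u ⟨hu, hux⟩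
      have h1 := houtside x hxb
      have hub : u ∉ branch T v e := by
        intro hub
        have h2 := hlow x hx
        have h3 := hupp u hu hub
        rcases hinside u hub with rfl | h4
        · omega
        · omega
      have := houtside u hub
      exact ⟨⟨hu, hub⟩, by omega⟩
  · push Not at hd
    have hinside : ∀ u ∈ branch T v e, u = e := by
      intro u hu
      rcases (mem_branch_iff hT he).1 hu with h1 | ⟨c, hc, hcv, huc⟩
      · exact h1
      · exact absurd (hd c hc) hcv
    have houtside : ∀ u, u ∉ branch T v e → T.dist u e = T.dist u v + 1 := by
      intro u hu
      rw [not_mem_branch hT he] at hu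
      exact hu
    refine win_of_probe e fun x hx => ?_
    by_cases hxb : x ∈ branch T v e
    · left
      obtain rfl := hinside x hxb
      rintro u ⟨-, hu⟩ w ⟨-, hw⟩
      simp only [SimpleGraph.dist_self] at hu hw
      rw [dist_eq_zero hT hu, dist_eq_zero hT hw]
    · refine (hout (T.dist x v)).mono ?_
      rintro u ⟨hu, hux⟩
      have h1 := houtside x hxb
      have hub : u ∉ branch T v e := by
        intro hub
        obtain rfl := hinside u hub
        simp only [SimpleGraph.dist_self] at hux
        omega
      have := houtside u hub
      exact ⟨⟨hu, hub⟩, by omega⟩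

/-- Probing a neighbor `c` of `v`. -/
lemma wins_of_split (hT : T.IsTree) [Finite V] {v c : V} (hc : T.Adj v c) {C : Set V} {h : ℕ}
    (hC : ∀ x ∈ C, T.dist x v = h) (hbr : Win T (insert v (branch T v c)))
    (hout : ∀ l, Wins T (level T (closedNbhd T C \ branch T v c) v l))
    (hmix : Wins T (level T (closedNbhd T C) c h)) : Wins T C := by
  right
  have hlev : ∀ u ∈ closedNbhd T C, h ≤ T.dist u v + 1 ∧ T.dist u v ≤ h + 1 := by
    intro u hu
    obtain ⟨s, hs, -, h1, h2⟩ := closedNbhd_dist hT hu v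
    have := hC s hs
    omega
  have hout' : ∀ u, u ∉ branch T v c → T.dist u c = T.dist u v + 1 := by
    intro u hu
    rw [not_mem_branch hT hc] at hu
    exact hu
  refine win_of_probe c fun x hx => ?_
  rcases lt_trichotomy (T.dist x c) h with hlt | heq | hgt
  · refine wins_of_subset_branch hT hc hbr ?_
    rintro u ⟨hu, hux⟩
    by_contra hub
    have := hout' u hub
    have := hlev u hu
    omega
  · refine hmix.mono ?_
    rintro u ⟨hu, hux⟩
    exact ⟨hu, by omega⟩
  · refine (hout (T.dist x c - 1)).mono ?_
    rintro u ⟨hu, hux⟩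
    have hub : u ∉ branch T v c := by
      intro hub
      have h1 : T.dist u v = T.dist u c + 1 := hub
      have := hlev u hu
      omega
    have := hout' u hub
    exact ⟨⟨hu, hub⟩, by omega⟩

/-- The union of the branches at `v` towards the vertices of `E`. -/
def branches (T : SimpleGraph V) (v : V) (E : Set V) : Set V := {x | ∃ e ∈ E, x ∈ branch T v e}

lemma good_union_branches (hT : T.IsTree) [Finite V] {v z : V} {Z : Set V} (E : Set V)
    (hE : ∀ e ∈ E, T.Adj v e ∧ ¬ Major T e ∧ Win T (insert v (branch T v e)))
    (hvZ : v ∈ Z) (hclosed : ∀ x ∈ Z, x ≠ v → x ≠ z → ∀ u, T.Adj x u → u ∈ Z)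
    (hbase : Good T v Z)
    (hspec : ∀ E' ⊆ E, ∀ e ∈ E, Good T v (Z ∪ branches T v E') →
      ∀ h, z ∈ level T (Z ∪ branches T v (insert e E')) v h →
        Wins T (level T (Z ∪ branches T v (insert e E')) v h)) :
    Good T v (Z ∪ branches T v E) := by
  suffices H : ∀ E' ⊆ E, Good T v (Z ∪ branches T v E') from H E subset_rfl
  intro E' hE'
  induction E', E'.toFinite using Set.Finite.induction_on with
  | empty => simpa [branches] using hbase
  | @insert e E' _ _ ih =>
    have hE'' : E' ⊆ E := fun x hx => hE' (Or.inr hx)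
    have heE := hE' (Or.inl rfl : e ∈ insert e E')
    have ih := ih hE''
    intro h
    by_cases hz : z ∈ level T (Z ∪ branches T v (insert e E')) v h
    · exact hspec E' hE'' e heE ih h hz
    rcases Nat.eq_zero_or_pos h with rfl | hpos
    · exact Or.inl (level_zero_subsingleton hT _ _)
    obtain ⟨hadj, hmin, hwin⟩ := hE e heE
    refine wins_of_minor hT hadj hmin hpos (fun x hx => hx.2.ge) (fun x hx _ => hx.2)
      (Or.inr hwin) fun l => (ih l).mono (level_mono ?_ v l)
    have hmem : ∀ x, x ∈ Z ∪ branches T v (insert e E') → x ∉ branch T v e →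
        x ∈ Z ∪ branches T v E' := by
      rintro x (hx | ⟨e', rfl | he', hx⟩) hxe
      · exact Or.inl hx
      · exact absurd hx hxe
      · exact Or.inr ⟨e', he', hx⟩
    rintro u ⟨hu | ⟨s, hs, hsu⟩, hue⟩
    · exact hmem u hu.1 hue
    · refine hmem u ?_ hue
      have hsv : s ≠ v := by
        rintro rfl
        have := hs.2
        simp at this
        omega
      have hsz : s ≠ z := by
        rintro rfl
        exact hz hs
      rcases hs.1 with hs' | ⟨e', he', hs'⟩
      · exact Or.inl (hclosed s hs' hsv hsz u hsu)
      · by_cases hu : u ∈ branch T v e'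
        · exact Or.inr ⟨e', he', hu⟩
        · obtain ⟨-, rfl⟩ := branch_boundary hT (hE e' (hE' he')).1 hsu hs' hu
          exact Or.inl hvZ

/-- No vertex of `T` has three distinct neighbors of degree at least three. -/
def NoTripleMajor (T : SimpleGraph V) : Prop :=
  ∀ o p q r, p ≠ q → p ≠ r → q ≠ r → T.Adj o p → T.Adj o q → T.Adj o r →
    Major T p → Major T q → ¬ Major T r

lemma exists_third {v p q : V} (h : Major T v) : ∃ e, T.Adj v e ∧ e ≠ p ∧ e ≠ q := by
  obtain ⟨a, b, c, hab, hac, hbc, ha, hb, hc⟩ := h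
  by_cases h1 : a ≠ p ∧ a ≠ q
  · exact ⟨a, ha, h1⟩
  by_cases h2 : b ≠ p ∧ b ≠ q
  · exact ⟨b, hb, h2⟩
  refine ⟨c, hc, ?_, ?_⟩ <;> grind

lemma mem_branches_of_adj (hT : T.IsTree) {v x u : V} {E : Set V} (hE : ∀ e ∈ E, T.Adj v e)
    (hx : x ∈ branches T v E) (hxu : T.Adj x u) : u = v ∨ u ∈ branches T v E := by
  obtain ⟨e, he, hxe⟩ := hx
  by_cases hu : u ∈ branch T v e
  · exact Or.inr ⟨e, he, hu⟩
  · exact Or.inl (branch_boundary hT (hE e he) hxu hxe hu).2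

lemma good_branches (hT : T.IsTree) [Finite V] {y z : V} {N : Set V} (hyz : T.Adj y z)
    (hzN : z ∉ N) (hN : ∀ n ∈ N, T.Adj y n ∧ Win T (insert y (branch T y n)))
    (hmaj : ∀ n ∈ N, ∀ n' ∈ N, Major T n → Major T n' → n = n') :
    Good T y (insert y (branches T y N)) := by
  have hz : ∀ N' ⊆ N, z ∉ insert y (branches T y N') := by
    rintro N' hN' (rfl | ⟨n, hn, hzn⟩)
    · exact hyz.ne rfl
    · exact hzN (mem_branch_of_adj hT hyz hzn ▸ hN' hn)
  have h1 := good_union_branches hT (z := z) (v := y)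
    (Z := insert y (branches T y {n ∈ N | Major T n})) {n ∈ N | ¬ Major T n}
    (fun e he => ⟨(hN e he.1).1, he.2, (hN e he.1).2⟩) (Or.inl rfl) ?_ ?_ ?_
  · refine h1.mono ?_
    rintro x (rfl | ⟨n, hn, hx⟩)
    · exact Or.inl (Or.inl rfl)
    · by_cases hm : Major T n
      · exact Or.inl (Or.inr ⟨n, ⟨hn, hm⟩, hx⟩)
      · exact Or.inr ⟨n, ⟨hn, hm⟩, hx⟩
  · rintro x (rfl | hx) hxy hxz u hu
    · exact absurd rfl hxy
    · exact mem_branches_of_adj hT (fun e he => (hN e he.1).1) hx hu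
  · refine good_insert hT fun l => ?_
    by_cases hb : ∃ b ∈ N, Major T b
    · obtain ⟨b, hb, hbm⟩ := hb
      refine wins_of_subset_branch hT (hN b hb).1 (hN b hb).2 ?_
      rintro x ⟨⟨n, hn, hx⟩, -⟩
      exact hmaj n hn.1 b hb hn.2 hbm ▸ hx
    · left
      rintro x ⟨⟨n, hn, -⟩, -⟩
      exact absurd ⟨n, hn⟩ hb
  · intro E' hE' e he _ h hz'
    exfalso
    refine hz N subset_rfl ?_
    rcases hz'.1 with (h2 | ⟨n, hn, h2⟩) | ⟨n, hn, h2⟩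
    · exact Or.inl h2
    · exact Or.inr ⟨n, hn.1, h2⟩
    · refine Or.inr ⟨n, ?_, h2⟩
      rcases hn with rfl | hn
      · exact he.1
      · exact (hE' hn).1

/-- The situation in which one cop has to clear the branch at `y` away from `z`, the branch at
`y` towards the vertex `a` of degree at least three being the last obstacle. -/
structure Stage (T : SimpleGraph V) (z y a : V) : Prop where
  tree : T.IsTree
  adj : T.Adj z y
  noTriple : NoTripleMajor T
  smaller : ∀ u v, T.Adj u v → (branch T u v).ncard < (branch T z y).ncard →
    Win T (insert u (branch T u v))
  adj_a : T.Adj y a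
  ne : a ≠ z
  major_y : Major T y
  major_a : Major T a
  minor_z : ¬ Major T z
  left : Good T y (branch T z y \ branch T y a)

namespace Stage

variable {z y a : V}

lemma sub (S : Stage T z y a) : branch T y a ⊆ branch T z y :=
  branch_subset S.tree S.adj S.adj_a S.ne

lemma dist_z (S : Stage T z y a) {x : V} (hx : x ∈ branch T y a) :
    T.dist z x = T.dist y x + 1 ∧ T.dist y x = T.dist a x + 1 := by
  have h1 : T.dist x z = T.dist x y + 1 := S.sub hx
  have h2 : T.dist x y = T.dist x a + 1 := hx
  simp only [T.dist_comm (v := x)]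
  exact ⟨h1, h2⟩

lemma win_smaller [Finite V] (S : Stage T z y a) {u v : V} (h : T.Adj u v)
    (hsub : branch T u v ⊆ branch T y a) : Win T (insert u (branch T u v)) :=
  S.smaller u v h (lt_of_le_of_lt (Set.ncard_le_ncard hsub (Set.toFinite _))
    (branch_ncard_lt S.tree S.adj S.adj_a S.ne))

lemma wins_of_mem [Finite V] (S : Stage T z y a) {v : V} (hv : v ∈ branch T y a) {C : Set V}
    {h : ℕ} (hC : C ⊆ insert z (branch T z y)) (hh : ∀ x ∈ C, T.dist x v = h) (hz : z ∈ C)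
    (hF : Wins T (level T (closedNbhd T C ∩ branch T z y) y 2)) : Wins T C := by
  have hT := S.tree
  have hzv := hh z hz
  obtain ⟨d1, d2⟩ := S.dist_z hv
  refine wins_of_minor hT S.adj.symm S.minor_z le_rfl ?_ ?_ (Or.inl rfl) ?_
  · intro x hx
    by_contra hx0
    have : x = y := dist_eq_zero hT (by omega)
    subst this
    have := hh x hx
    omega
  · intro x hx hxb
    rcases hC hx with rfl | hx'
    · exact dist_adj S.adj
    · exact absurd hx' ((not_mem_branch hT S.adj).2 hxb)
  · intro l
    have hmem : ∀ x, x ∈ closedNbhd T C \ branch T y z → x ∈ closedNbhd T C ∩ branch T z y :=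
      fun x hx => ⟨hx.1, (not_mem_branch hT S.adj.symm).1 hx.2⟩
    have hnear : ∀ x ∈ closedNbhd T C, T.dist x v ≤ h + 1 ∧ h ≤ T.dist x v + 1 := by
      intro x hx
      obtain ⟨s, hs, -, h1, h2⟩ := closedNbhd_dist hT hx v
      have := hh s hs
      omega
    obtain rfl | rfl | rfl | hl : l = 0 ∨ l = 1 ∨ l = 2 ∨ 3 ≤ l := by omega
    · exact Or.inl (level_zero_subsingleton hT _ _)
    · refine (S.left 1).mono ?_
      rintro x ⟨hx, hxy⟩
      refine ⟨⟨(hmem x hx).2, fun hxa => ?_⟩, hxy⟩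
      have hxa' : T.dist x y = T.dist x a + 1 := hxa
      have : x = a := dist_eq_zero hT (by omega)
      subst this
      have := hnear x hx.1
      omega
    · refine hF.mono ?_
      rintro x ⟨hx, hxy⟩
      exact ⟨hmem x hx, hxy⟩
    · refine wins_of_subset_branch hT S.adj_a (S.win_smaller S.adj_a subset_rfl) ?_
      rintro x ⟨hx, hxy⟩
      by_contra hxa
      have h1 := dist_across hT S.adj_a hv hxa
      have := hnear x hx.1
      rw [T.dist_comm (u := v) (v := x), T.dist_comm (u := y) (v := x),
        T.dist_comm (u := v) (v := a)] at h1
      omega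

lemma wins_second_level [Finite V] (S : Stage T z y a) {F A : Set V} {e : V}
    (hd : ∀ x ∈ F, T.dist x y = 2) (he : T.Adj a e) (hey : e ≠ y)
    (hmin : ¬ Major T e) (hA : closedNbhd T F \ branch T a e ⊆ A) (hgood : Good T a A) :
    Wins T F := by
  have hT := S.tree
  refine wins_of_minor hT he hmin le_rfl ?_ ?_ (Or.inl rfl) fun l =>
    (hgood l).mono (level_mono hA a l)
  · intro x hx
    by_contra hx0
    have : x = a := dist_eq_zero hT (by omega)
    subst this
    have h1 := hd x hx
    rw [dist_adj S.adj_a.symm] at h1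
    omega
  · intro x hx hxe
    have h1 : T.dist x y = T.dist x a + 1 := branch_subset hT S.adj_a he hey hxe
    have := hd x hx
    omega

lemma closedNbhd_sub (S : Stage T z y a) {C : Set V} (hC : C ⊆ branch T z y) :
    closedNbhd T C ⊆ insert z (branch T z y) := closedNbhd_branch_subset S.tree S.adj hC

lemma good_shift (hT : T.IsTree) {u v : V} (h : T.Adj u v) {A : Set V}
    (hA : Good T u (A \ branch T u v)) : Good T v (A \ branch T u v) := by
  intro l
  refine (hA (l - 1)).mono ?_
  rintro x ⟨hx, hxl⟩
  have : T.dist x v = T.dist x u + 1 := (not_mem_branch hT h).1 hx.2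
  exact ⟨hx, by omega⟩

lemma good_step [Finite V] (S : Stage T z y a) {u v : V} (h : T.Adj u v)
    (hsub : branch T u v ⊆ branch T y a) (hu : Major T u)
    (hgood : Good T v (insert z (branch T z y) \ branch T u v))
    (hspec : ∀ E' ⊆ {c | T.Adj v c ∧ c ≠ u ∧ ¬ Major T c},
      ∀ e ∈ {c | T.Adj v c ∧ c ≠ u ∧ ¬ Major T c},
      Good T v (insert v (insert z (branch T z y) \ branch T u v) ∪ branches T v E') →
      ∀ h, z ∈ level T (insert v (insert z (branch T z y) \ branch T u v) ∪
          branches T v (insert e E')) v h →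
        Wins T (level T (insert v (insert z (branch T z y) \ branch T u v) ∪
          branches T v (insert e E')) v h))
    (hnext : ∀ w, T.Adj v w → w ≠ u → Major T w →
      Good T v (insert z (branch T z y) \ branch T v w) → Good T w (branch T z y)) :
    Good T v (branch T z y) := by
  have hT := S.tree
  have hE := good_union_branches hT {c | T.Adj v c ∧ c ≠ u ∧ ¬ Major T c}
    (fun e he => ⟨he.1, he.2.2,
      S.win_smaller he.1 ((branch_subset hT h he.1 he.2.1).trans hsub)⟩) (Or.inl rfl) (z := z)
    (v := v) (Z := insert v (insert z (branch T z y) \ branch T u v)) ?_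
    (good_insert hT hgood) hspec
  · have hcover : ∀ x ∈ insert z (branch T z y),
        (∀ w, T.Adj v w → w ≠ u → Major T w → x ∉ branch T v w) →
        x ∈ insert v (insert z (branch T z y) \ branch T u v) ∪
          branches T v {c | T.Adj v c ∧ c ≠ u ∧ ¬ Major T c} := by
      intro x hx hxw
      by_cases hxb : x ∈ branch T u v
      · rcases (mem_branch_iff hT h).1 hxb with rfl | ⟨c, hc, hcu, hxc⟩
        · exact Or.inl (Or.inl rfl)
        · exact Or.inr ⟨c, ⟨hc, hcu, fun hm => hxw c hc hcu hm hxc⟩, hxc⟩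
      · exact Or.inl (Or.inr ⟨hx, hxb⟩)
    by_cases hw : ∃ w, T.Adj v w ∧ w ≠ u ∧ Major T w
    · obtain ⟨w, hvw, hwu, hwm⟩ := hw
      have huniq : ∀ w', T.Adj v w' → w' ≠ u → Major T w' → w' = w := by
        intro w' h1 h2 h3
        by_contra hne
        exact S.noTriple v u w w' hwu.symm h2.symm (Ne.symm hne) h.symm hvw h1 hu hwm h3
      have hgw : Good T v (insert z (branch T z y) \ branch T v w) := by
        refine hE.mono ?_
        rintro x ⟨hx, hxw⟩
        refine hcover x hx fun w' h1 h2 h3 => ?_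
        rw [huniq w' h1 h2 h3]
        exact hxw
      have hY := hnext w hvw hwu hwm hgw
      have hsubw := (branch_subset hT h hvw hwu).trans hsub
      intro l
      refine wins_of_split hT hvw (h := l) (fun x hx => hx.2) (S.win_smaller hvw hsubw) ?_ ?_
      · intro k
        refine (hgw k).mono (level_mono ?_ v k)
        rintro x ⟨hx, hxw⟩
        exact ⟨S.closedNbhd_sub (fun _ h => h.1) hx, hxw⟩
      · refine (hY l).mono ?_
        rintro x ⟨hx, hxl⟩
        refine ⟨?_, hxl⟩
        rcases S.closedNbhd_sub (fun _ h => h.1) hx with rfl | hx'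
        · exfalso
          rcases hx with hx | ⟨s, hs, hsx⟩
          · exact not_mem_branch_left hx.1
          · obtain ⟨rfl, -⟩ := branch_boundary hT S.adj hsx hs.1 not_mem_branch_left
            have h1 := S.dist_z (hsubw (mem_branch_self hvw))
            have h2 := S.dist_z (hsub (mem_branch_self h))
            have h3 := hs.2
            have hsw : s ∉ branch T v w := fun hm => not_mem_branch_left (hsubw hm)
            have h4 : T.dist s w = T.dist s v + 1 := (not_mem_branch hT hvw).1 hsw
            omega
        · exact hx'
    · refine hE.mono fun x hx => hcover x (Or.inr hx) fun w h1 h2 h3 => ?_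
      exact absurd ⟨w, h1, h2, h3⟩ hw
  · rintro x (rfl | ⟨hx, hxb⟩) hxv hxz t ht
    · exact absurd rfl hxv
    · have hx' : x ∈ branch T z y := hx.resolve_left hxz
      by_cases htb : t ∈ branch T u v
      · exact Or.inl (branch_boundary hT h ht.symm htb hxb).1
      · refine Or.inr ⟨?_, htb⟩
        by_cases hty : t ∈ branch T z y
        · exact Or.inr hty
        · exact Or.inl (branch_boundary hT S.adj ht hx' hty).2

lemma union_sub (S : Stage T z y a) {u v : V} (h : T.Adj u v)
    (hsub : branch T u v ⊆ branch T y a) {E : Set V}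
    (hE : ∀ c ∈ E, T.Adj v c ∧ c ≠ u) :
    insert v (insert z (branch T z y) \ branch T u v) ∪ branches T v E ⊆
      insert z (branch T z y) := by
  rintro x ((rfl | hx) | ⟨c, hc, hx⟩)
  · exact Or.inr (S.sub (hsub (mem_branch_self h)))
  · exact hx.1
  · exact Or.inr (S.sub (hsub (branch_subset S.tree h (hE c hc).1 (hE c hc).2 hx)))

lemma good_deep [Finite V] (S : Stage T z y a) {w₀ : V} (hw₀ : T.Adj a w₀) (hw₀y : w₀ ≠ y)
    (hF : Wins T (level T (branch T z y \ branch T a w₀) y 2)) (n : ℕ) :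
    ∀ u v, (branch T u v).ncard ≤ n → T.Adj u v → branch T u v ⊆ branch T a w₀ → Major T u →
      Major T v → Good T v (insert z (branch T z y) \ branch T u v) →
      Good T v (branch T z y) := by
  have hT := S.tree
  have hsub₀ := branch_subset hT S.adj_a hw₀ hw₀y
  induction n with
  | zero =>
    intro u v hn h
    rw [Nat.le_zero, Set.ncard_eq_zero] at hn
    exact absurd (mem_branch_self h) (hn ▸ Set.notMem_empty v)
  | succ n ih =>
    intro u v hn h hsub hu hv hgood
    refine S.good_step h (hsub.trans hsub₀) hu hgood ?_ ?_
    · intro E' hE' e he _ l hz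
      have hE : ∀ c ∈ insert e E', T.Adj v c ∧ c ≠ u := by
        rintro c (rfl | hc)
        · exact ⟨he.1, he.2.1⟩
        · exact ⟨(hE' hc).1, (hE' hc).2.1⟩
      refine S.wins_of_mem (hsub₀ (hsub (mem_branch_self h)))
        (fun x hx => S.union_sub h (hsub.trans hsub₀) hE hx.1) (h := l) (fun x hx => hx.2) hz ?_
      refine hF.mono ?_
      rintro x ⟨⟨hxN, hxY⟩, hxy⟩
      refine ⟨⟨hxY, fun hxw => ?_⟩, hxy⟩
      have h1 : T.dist x y = T.dist x a + 1 := hsub₀ hxw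
      have h2 : T.dist x a = T.dist x w₀ + 1 := hxw
      have : x = w₀ := dist_eq_zero hT (by omega)
      subst this
      obtain ⟨s, hs, -, h3, h4⟩ := closedNbhd_dist hT hxN v
      have h5 := hs.2
      have h6 := hz.2
      obtain ⟨h7, h8⟩ := S.dist_z (hsub₀ (hsub (mem_branch_self h)))
      have h9 : T.dist v a = T.dist v x + 1 := hsub (mem_branch_self h)
      rw [T.dist_comm (u := v), T.dist_comm (u := v)] at h9
      omega
    · intro w hvw hwu hwm hgw
      refine ih v w ?_ hvw ((branch_subset hT h hvw hwu).trans hsub) hv hwm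
        (good_shift hT hvw hgw)
      have := branch_ncard_lt hT h hvw hwu
      omega

lemma good_a_sdiff [Finite V] (S : Stage T z y a) :
    Good T a (insert z (branch T z y) \ branch T y a) := by
  have hT := S.tree
  intro l
  by_cases hz : z ∈ level T (insert z (branch T z y) \ branch T y a) a l
  · have hl : l = 2 := by
      have h1 := hz.2
      have h2 := S.dist_z (mem_branch_self S.adj_a)
      rw [dist_adj S.adj_a] at h2
      omega
    subst hl
    have hC : ∀ x ∈ level T (insert z (branch T z y) \ branch T y a) a 2, T.dist x y = 1 := by
      rintro x ⟨⟨-, hx⟩, hx2⟩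
      have : T.dist x a = T.dist x y + 1 := (not_mem_branch hT S.adj_a).1 hx
      omega
    refine wins_of_minor hT S.adj.symm S.minor_z le_rfl (fun x hx => (hC x hx).ge)
      (fun x hx _ => hC x hx) (Or.inl rfl) fun k => (S.left k).mono (level_mono ?_ y k)
    rintro x ⟨hx, hxz⟩
    refine ⟨(not_mem_branch hT S.adj.symm).1 hxz, fun hxa => ?_⟩
    rcases hx with hx | ⟨s, hs, hsx⟩
    · exact hx.1.2 hxa
    · obtain ⟨-, rfl⟩ := branch_boundary hT S.adj_a hsx.symm hxa hs.1.2
      have := hC s hs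
      simp at this
  · refine (S.left (l - 1)).mono ?_
    rintro x ⟨⟨hx, hxa⟩, hxl⟩
    have : T.dist x a = T.dist x y + 1 := (not_mem_branch hT S.adj_a).1 hxa
    refine ⟨⟨hx.resolve_left ?_, hxa⟩, by omega⟩
    rintro rfl
    exact hz ⟨⟨hx, hxa⟩, hxl⟩

lemma good_a [Finite V] (S : Stage T z y a) : Good T a (branch T z y) := by
  have hT := S.tree
  refine S.good_step S.adj_a subset_rfl S.major_y S.good_a_sdiff ?_ ?_
  · intro E' hE' e he hgood l hz
    have hE : ∀ c ∈ insert e E', T.Adj a c ∧ c ≠ y := by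
      rintro c (rfl | hc)
      · exact ⟨he.1, he.2.1⟩
      · exact ⟨(hE' hc).1, (hE' hc).2.1⟩
    have hl : l = 2 := by
      have h1 := hz.2
      have h2 := S.dist_z (mem_branch_self S.adj_a)
      rw [dist_adj S.adj_a] at h2
      omega
    subst hl
    refine S.wins_of_mem (mem_branch_self S.adj_a)
      (fun x hx => S.union_sub S.adj_a subset_rfl hE hx.1) (h := 2) (fun x hx => hx.2) hz ?_
    refine S.wins_second_level (e := e) (fun x hx => hx.2) he.1 he.2.1
      he.2.2 ?_ hgood
    rintro x ⟨hx, hxe⟩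
    by_cases hxa : x ∈ branch T y a
    · rcases (mem_branch_iff hT S.adj_a).1 hxa with rfl | ⟨c, hac, hcy, hxc⟩
      · exact Or.inl (Or.inl rfl)
      · right
        have hcsub := branch_subset hT S.adj_a hac hcy
        have hs : ∃ s ∈ branch T a c, s ∈ level T (closedNbhd T (level T (insert a
            (insert z (branch T z y) \ branch T y a) ∪ branches T a (insert e E')) a 2) ∩
            branch T z y) y 2 := by
          rcases hx with hx | ⟨s, hs, hsx⟩
          · exact ⟨x, hxc, hx⟩
          · refine ⟨s, ?_, hs⟩
            by_contra hsc
            obtain ⟨-, rfl⟩ := branch_boundary hT hac hsx.symm hxc hsc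
            have := hs.2
            rw [dist_adj S.adj_a.symm] at this
            omega
        obtain ⟨s, hsc, ⟨hsN, -⟩, hsy⟩ := hs
        have h1 : T.dist s y = T.dist s a + 1 := hcsub hsc
        have ht : ∃ t ∈ branch T a c, t ∈ level T (insert a
            (insert z (branch T z y) \ branch T y a) ∪ branches T a (insert e E')) a 2 := by
          rcases hsN with hs | ⟨t, ht, hts⟩
          · exact ⟨s, hsc, hs⟩
          · refine ⟨t, ?_, ht⟩
            by_contra htc
            obtain ⟨-, rfl⟩ := branch_boundary hT hac hts.symm hsc htc
            have := ht.2
            simp at this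
        obtain ⟨t, htc, ht, -⟩ := ht
        rcases ht with (rfl | ht) | ⟨e', he', ht⟩
        · exact absurd htc not_mem_branch_left
        · exact absurd (hcsub htc) ht.2
        · have : c = e' := closer_unique hT hac (hE e' he').1 htc ht
          subst this
          rcases he' with rfl | he'
          · exact absurd hxc hxe
          · exact ⟨c, he', hxc⟩
    · exact Or.inl (Or.inr ⟨S.closedNbhd_sub (fun x hx => hx.1.2) hx, hxa⟩)
  · intro w haw hwy hwm hgw
    obtain ⟨e, he, hey, hew⟩ := exists_third (p := y) (q := w) S.major_a
    have hemin : ¬ Major T e :=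
      S.noTriple a y w e hwy.symm hey.symm hew.symm S.adj_a.symm haw he S.major_y hwm
    refine S.good_deep haw hwy ?_ _ a w le_rfl haw subset_rfl S.major_a hwm
      (good_shift hT haw hgw)
    refine S.wins_second_level (fun x hx => hx.2) he hey hemin ?_ hgw
    rintro x ⟨hx, -⟩
    refine ⟨S.closedNbhd_sub (fun x hx => hx.1.1) hx, fun hxw => ?_⟩
    rcases hx with hx | ⟨s, hs, hsx⟩
    · exact hx.1.2 hxw
    · obtain ⟨-, rfl⟩ := branch_boundary hT haw hsx.symm hxw hs.1.2
      have := hs.2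
      rw [dist_adj S.adj_a.symm] at this
      omega

lemma good_y [Finite V] (S : Stage T z y a) : Good T y (branch T z y) := by
  have hT := S.tree
  intro l
  rcases Nat.eq_zero_or_pos l with rfl | hl
  · exact Or.inl (level_zero_subsingleton hT _ _)
  have hN : closedNbhd T (level T (branch T z y) y l) ⊆ branch T z y := by
    rintro x (hx | ⟨s, hs, hsx⟩)
    · exact hx.1
    · by_contra hx
      obtain ⟨rfl, -⟩ := branch_boundary hT S.adj hsx hs.1 hx
      have := hs.2
      simp at this
      omega
  refine wins_of_split hT S.adj_a (h := l) (fun x hx => hx.2) (S.win_smaller S.adj_a subset_rfl)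
    (fun k => (S.left k).mono (level_mono ?_ y k)) ((S.good_a l).mono (level_mono hN a l))
  rintro x ⟨hx, hxa⟩
  exact ⟨hN hx, hxa⟩

end Stage

lemma win_branch (hT : T.IsTree) [Finite V] (hH : NoTripleMajor T) (n : ℕ) :
    ∀ z y, (branch T z y).ncard ≤ n → T.Adj z y → Win T (insert z (branch T z y)) := by
  induction n with
  | zero =>
    intro u v hn h
    rw [Nat.le_zero, Set.ncard_eq_zero] at hn
    exact absurd (mem_branch_self h) (hn ▸ Set.notMem_empty v)
  | succ n ih =>
    intro z y hn hzy
    have hsm : ∀ u v, T.Adj u v → (branch T u v).ncard < (branch T z y).ncard →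
        Win T (insert u (branch T u v)) := fun u v h hlt => ih u v (by omega) h
    have hN : ∀ N : Set V, (∀ c ∈ N, T.Adj y c ∧ c ≠ z) → ∀ c ∈ N,
        T.Adj y c ∧ Win T (insert y (branch T y c)) := fun N h c hc =>
      ⟨(h c hc).1, hsm y c (h c hc).1 (branch_ncard_lt hT hzy (h c hc).1 (h c hc).2)⟩
    suffices hgood : Good T y (branch T z y) by
      refine win_of_probe z fun x hx => ?_
      rcases hx with rfl | hx
      · left
        rintro u ⟨-, hu⟩ w ⟨-, hw⟩
        simp only [SimpleGraph.dist_self] at hu hw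
        rw [dist_eq_zero hT hu, dist_eq_zero hT hw]
      · refine (hgood (T.dist x y)).mono ?_
        have h1 : T.dist x z = T.dist x y + 1 := hx
        rintro u ⟨rfl | hu, hux⟩
        · simp at hux
          omega
        · have h2 : T.dist u z = T.dist u y + 1 := hu
          exact ⟨hu, by omega⟩
    by_cases hab : ∃ a b, T.Adj y a ∧ T.Adj y b ∧ a ≠ z ∧ b ≠ z ∧ a ≠ b ∧ Major T a ∧ Major T b
    · obtain ⟨a, b, ha, hb, haz, hbz, hab, ham, hbm⟩ := hab
      refine Stage.good_y (a := a) ⟨hT, hzy, hH, hsm, ha, haz,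
        ⟨z, a, b, haz.symm, hbz.symm, hab, hzy.symm, ha, hb⟩, ham,
        hH y a b z hab haz hbz ha hb hzy.symm ham hbm, ?_⟩
      refine (good_branches hT hzy.symm (N := {c | T.Adj y c ∧ c ≠ z ∧ c ≠ a}) (by simp)
        (hN _ fun c hc => ⟨hc.1, hc.2.1⟩) ?_).mono ?_
      · intro c hc c' hc' hm hm'
        by_contra hne
        exact hH y a c c' hc.2.2.symm hc'.2.2.symm hne ha hc.1 hc'.1 ham hm hm'
      · rintro x ⟨hx, hxa⟩
        rcases (mem_branch_iff hT hzy).1 hx with rfl | ⟨c, hc, hcz, hxc⟩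
        · exact Or.inl rfl
        · refine Or.inr ⟨c, ⟨hc, hcz, ?_⟩, hxc⟩
          rintro rfl
          exact hxa hxc
    · refine (good_branches hT hzy.symm (N := {c | T.Adj y c ∧ c ≠ z}) (by simp)
        (hN _ fun c hc => hc) ?_).mono ?_
      · intro c hc c' hc' hm hm'
        by_contra hne
        exact hab ⟨c, c', hc.1, hc'.1, hc.2, hc'.2, hne, hm, hm'⟩
      · intro x hx
        rcases (mem_branch_iff hT hzy).1 hx with rfl | ⟨c, hc, hcz, hxc⟩
        · exact Or.inl rfl
        · exact Or.inr ⟨c, ⟨hc, hcz⟩, hxc⟩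

/-! ### Betweenness and medians -/

/-- The vertex `m` lies on the path from `x` to `y`. -/
def Btw (T : SimpleGraph V) (x m y : V) : Prop := T.dist x m + T.dist m y = T.dist x y

lemma Btw.symm {x m y : V} (h : Btw T x m y) : Btw T y m x := by
  unfold Btw at *
  rw [T.dist_comm (u := y) (v := m), T.dist_comm (u := m) (v := x), T.dist_comm (u := y) (v := x)]
  omega

lemma Btw.trans (hT : T.IsTree) {u m w l : V} (h1 : Btw T u m w) (h2 : Btw T u w l) :
    Btw T u m l := by
  have h3 := hT.connected.dist_triangle (u := m) (v := w) (w := l)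
  have h4 := hT.connected.dist_triangle (u := u) (v := m) (w := l)
  unfold Btw at *
  omega

lemma btw_of_notMem (hT : T.IsTree) {x w y c : V} (hc : T.Adj w c) (hx : x ∈ branch T w c)
    (hy : y ∉ branch T w c) : Btw T x w y := by
  have h1 := dist_across hT hc hx hy
  have h2 : T.dist x w = T.dist x c + 1 := hx
  unfold Btw
  omega

lemma not_btw_of_mem (hT : T.IsTree) {x w y c : V} (hx : x ∈ branch T w c)
    (hy : y ∈ branch T w c) : ¬ Btw T x w y := by
  have h1 : T.dist x w = T.dist x c + 1 := hx
  have h2 : T.dist y w = T.dist y c + 1 := hy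
  have h3 := hT.connected.dist_triangle (u := x) (v := c) (w := y)
  unfold Btw
  rw [T.dist_comm (u := w), h1, h2]
  rw [T.dist_comm (u := c)] at h3
  omega

lemma not_btw_iff (hT : T.IsTree) {x w y : V} :
    ¬ Btw T x w y ↔ ∃ c, T.Adj w c ∧ x ∈ branch T w c ∧ y ∈ branch T w c := by
  constructor
  · intro h
    have hx : x ≠ w := by
      rintro rfl
      simp [Btw] at h
    obtain ⟨c, hc, hxc⟩ := exists_branch hT hx
    exact ⟨c, hc, hxc, by_contra fun hy => h (btw_of_notMem hT hc hxc hy)⟩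
  · rintro ⟨c, hc, hx, hy⟩
    exact not_btw_of_mem hT hx hy

lemma Btw.or (hT : T.IsTree) {x m y : V} (h : Btw T x m y) (z : V) :
    Btw T x m z ∨ Btw T z m y := by
  by_contra! hcon
  obtain ⟨h1, h2⟩ := hcon
  obtain ⟨c, hc, hx, hz⟩ := (not_btw_iff hT).1 h1
  obtain ⟨d, hd, hz', hy⟩ := (not_btw_iff hT).1 h2
  obtain rfl := closer_unique hT hc hd hz hz'
  exact not_btw_of_mem hT hx hy h

lemma btw_unique (hT : T.IsTree) {a b m m' : V} (h : Btw T a m b) (h' : Btw T a m' b)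
    (hd : T.dist a m = T.dist a m') : m = m' := by
  refine dist_eq_zero hT ?_
  rcases h.or hT m' with h1 | h1
  · unfold Btw at *
    omega
  · unfold Btw at *
    rw [T.dist_comm (u := m')] at h1
    omega

lemma exists_median (hT : T.IsTree) (x a b : V) :
    ∃ m, Btw T a m b ∧ Btw T x m a ∧ Btw T x m b := by
  have hne : ∃ n, ∃ m, Btw T a m b ∧ T.dist x m = n := ⟨_, a, by simp [Btw], rfl⟩
  classical
  obtain ⟨m, hm, hmn⟩ := Nat.find_spec hne
  have hmin : ∀ c, Btw T a c b → T.dist x m ≤ T.dist x c := by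
    intro c hc
    rw [hmn]
    exact Nat.find_min' hne ⟨c, hc, rfl⟩
  have key : ∀ a b, Btw T a m b → (∀ c, Btw T a c b → T.dist x m ≤ T.dist x c) →
      Btw T x m a := by
    intro a b hm hmin
    by_contra h
    obtain ⟨c, hc, hx, ha⟩ := (not_btw_iff hT).1 h
    have hb : b ∉ branch T m c := fun hb => not_btw_of_mem hT ha hb hm
    have h1 := dist_across hT hc ha hb
    have h2 := dist_across hT hc (mem_branch_self hc) hb
    have h3 : T.dist x m = T.dist x c + 1 := hx
    have h4 := hmin c (by simp only [SimpleGraph.dist_self] at h2; unfold Btw; omega)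
    omega
  exact ⟨m, hm, key a b hm hmin, key b a hm.symm fun c hc => hmin c hc.symm⟩

lemma median_unique (hT : T.IsTree) {a b x u m m' : V} (ha : T.dist u a = T.dist x a)
    (hb : T.dist u b = T.dist x b) (h1 : Btw T a m b) (h2 : Btw T x m a) (h3 : Btw T x m b)
    (h1' : Btw T a m' b) (h2' : Btw T u m' a) (h3' : Btw T u m' b) : m = m' := by
  refine btw_unique hT h1 h1' ?_
  unfold Btw at *
  rw [T.dist_comm (u := a) (v := m)] at *
  rw [T.dist_comm (u := a) (v := m')] at *
  omega

/-! ### Leaves -/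

/-- A vertex with at most one neighbor. -/
def Leaf (T : SimpleGraph V) (l : V) : Prop := ∀ c c', T.Adj l c → T.Adj l c' → c = c'

lemma exists_leaf_beyond [Finite V] (hT : T.IsTree) (w x : V) :
    ∃ a, Leaf T a ∧ Btw T w x a := by
  obtain ⟨a, ha, hmax⟩ := (Set.toFinite {a | Btw T w x a}).exists_maximalFor (T.dist w) _
    ⟨x, by simp [Btw]⟩
  refine ⟨a, ?_, ha⟩
  have hw : ∀ c, T.Adj a c → w ∈ branch T a c := by
    intro c hc
    by_contra hwc
    have h1 : T.dist w c = T.dist w a + 1 := (not_mem_branch hT hc).1 hwc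
    have h2 := (dist_adj_le hT hc x).2
    have h3 := hT.connected.dist_triangle (u := w) (v := x) (w := c)
    have h4 : Btw T w x a := ha
    have h5 : Btw T w x c := by
      unfold Btw at *
      omega
    have := hmax h5 (by omega)
    omega
  exact fun c c' hc hc' => closer_unique hT hc hc' (hw c hc) (hw c' hc')

/-- The leaves of the branches at `w` that meet `C`. -/
def leavesBeyond (T : SimpleGraph V) (w : V) (C : Set V) : Set V :=
  {l | Leaf T l ∧ ∃ x ∈ C, ¬ Btw T x w l}

lemma exists_two_leaves [Finite V] (hT : T.IsTree) {w x₁ x₂ : V} {C : Set V} {δ : ℕ}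
    (hC : ∀ x ∈ C, T.dist x w = δ) (h₁ : x₁ ∈ C) (h₂ : x₂ ∈ C) (hne : x₁ ≠ x₂) :
    ∃ a b, a ≠ b ∧ a ∈ leavesBeyond T w C ∧ b ∈ leavesBeyond T w C ∧
      ¬ Btw T x₁ w a ∧ ¬ Btw T x₂ w b := by
  have hδ : 0 < δ := by
    by_contra h0
    refine hne ?_
    rw [dist_eq_zero hT (show T.dist x₁ w = 0 by have := hC _ h₁; omega),
      dist_eq_zero hT (show T.dist x₂ w = 0 by have := hC _ h₂; omega)]
  have key : ∀ x ∈ C, ∃ a, Leaf T a ∧ Btw T w x a ∧ ¬ Btw T x w a := by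
    intro x hx
    have hxw := hC x hx
    obtain ⟨a, ha, hb⟩ := exists_leaf_beyond hT w x
    refine ⟨a, ha, hb, ?_⟩
    unfold Btw at *
    rw [T.dist_comm (u := w) (v := x)] at hb
    omega
  obtain ⟨a, ha, hxa, hna⟩ := key _ h₁
  obtain ⟨b, hb, hxb, hnb⟩ := key _ h₂
  refine ⟨a, b, ?_, ⟨ha, _, h₁, hna⟩, ⟨hb, _, h₂, hnb⟩, hna, hnb⟩
  rintro rfl
  refine hne (btw_unique hT hxa hxb ?_)
  rw [T.dist_comm, hC _ h₁, T.dist_comm, hC _ h₂]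

/-! ### The game with two cops -/

/-- After probing two vertices `a` and `b`, the candidates are equidistant from some vertex `m`
of the path from `a` to `b`, which separates them from `a` and `b`. -/
lemma exists_center (hT : T.IsTree) (a b x : V) (S : Set V) :
    ∃ m δ, Btw T a m b ∧ ∀ u ∈ S, T.dist u a = T.dist x a → T.dist u b = T.dist x b →
      T.dist u m = δ ∧ Btw T u m a ∧ Btw T u m b := by
  obtain ⟨m, h1, h2, h3⟩ := exists_median hT x a b
  refine ⟨m, T.dist x m, h1, fun u _ hua hub => ?_⟩
  obtain ⟨m', h1', h2', h3'⟩ := exists_median hT u a b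
  obtain rfl := median_unique hT hua hub h1 h2 h3 h1' h2' h3'
  refine ⟨?_, h2', h3'⟩
  unfold Btw at *
  omega

lemma capt_two_of_pair {a b : V} {t : ℕ} {S : Set V}
    (h : ∀ x ∈ S, {u ∈ S | T.dist u a = T.dist x a ∧ T.dist u b = T.dist x b}.Subsingleton ∨
      capt T 2 t (closedNbhd T {u ∈ S | T.dist u a = T.dist x a ∧ T.dist u b = T.dist x b})) :
    capt T 2 (t + 1) S := by
  classical
  refine ⟨{a, b}, Finset.card_le_two, fun x hx => ?_⟩
  simpa using h x hx

lemma capt_two_of_leavesBeyond [Finite V] (hT : T.IsTree) (t : ℕ) : ∀ (δ : ℕ) (w : V) (C : Set V),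
    (∀ x ∈ C, T.dist x w = δ) → (leavesBeyond T w C).ncard ≤ 2 * t + 1 →
    C.Subsingleton ∨ capt T 2 t (closedNbhd T C) := by
  induction t with
  | zero =>
    intro δ w C hC hL
    left
    intro x₁ h₁ x₂ h₂
    by_contra hne
    obtain ⟨a, b, hab, ha, hb, -, -⟩ := exists_two_leaves hT hC h₁ h₂ hne
    exact hab ((Set.ncard_le_one_iff (Set.toFinite _)).1 hL ha hb)
  | succ t iht =>
    intro δ
    induction δ with
    | zero =>
      intro w C hC _
      left
      intro x hx y hy
      rw [dist_eq_zero hT (hC x hx), dist_eq_zero hT (hC y hy)]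
    | succ δ ihδ =>
      intro w C hC hL
      by_cases hsub : C.Subsingleton
      · exact Or.inl hsub
      by_cases hone : ∃ c, T.Adj w c ∧ C ⊆ branch T w c
      · obtain ⟨c, hc, hCc⟩ := hone
        refine ihδ c C ?_ ((Set.ncard_le_ncard ?_ (Set.toFinite _)).trans hL)
        · intro x hx
          have h1 := hC x hx
          have h2 : T.dist x w = T.dist x c + 1 := hCc hx
          omega
        · rintro l ⟨hl, x, hx, hxl⟩
          refine ⟨hl, x, hx, fun h => hxl ?_⟩
          have hlc : l ∉ branch T w c := fun hlc => not_btw_of_mem hT (hCc hx) hlc h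
          have h1 := dist_across hT hc (hCc hx) hlc
          have h2 := dist_across hT hc (mem_branch_self hc) hlc
          simp only [SimpleGraph.dist_self] at h2
          unfold Btw
          omega
      · right
        have hCw : ∀ x ∈ C, x ≠ w := by
          rintro x hx rfl
          have := hC x hx
          simp at this
        obtain ⟨x₁, h₁⟩ : C.Nonempty := Set.nonempty_iff_ne_empty.2 fun h => hsub (by simp [h])
        obtain ⟨c, hc, h₁c⟩ := exists_branch hT (hCw x₁ h₁)
        obtain ⟨x₂, h₂, h₂c⟩ : ∃ x₂ ∈ C, x₂ ∉ branch T w c := by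
          by_contra! h
          exact hone ⟨c, hc, h⟩
        have h₁₂ : Btw T x₁ w x₂ := btw_of_notMem hT hc h₁c h₂c
        obtain ⟨a, b, hab, ha, hb, h₁a, h₂b⟩ := exists_two_leaves hT hC h₁ h₂ (by
          rintro rfl
          exact h₂c h₁c)
        have hawb : Btw T a w b := by
          rcases h₁₂.or hT a with h | h
          · exact absurd h h₁a
          rcases h.or hT b with h | h
          · exact h
          · exact absurd h.symm h₂b
        refine capt_two_of_pair (a := a) (b := b) fun x _ => ?_
        obtain ⟨m, δ', hm, hu⟩ := exists_center hT a b x (closedNbhd T C)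
        refine iht δ' m _ (fun u h => (hu u h.1 h.2.1 h.2.2).1) ?_
        have hle : (leavesBeyond T w C \ {a, b}).ncard ≤ 2 * t + 1 := by
          have h1 := Set.ncard_sdiff_add_ncard_of_subset (s := {a, b}) (t := leavesBeyond T w C)
            (by rintro _ (rfl | rfl) <;> assumption) (Set.toFinite _)
          rw [Set.ncard_pair hab] at h1
          omega
        refine (Set.ncard_le_ncard ?_ (Set.toFinite _)).trans hle
        rintro l ⟨hl, u, ⟨huN, hua, hub⟩, hul⟩
        obtain ⟨-, hma, hmb⟩ := hu u huN hua hub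
        refine ⟨⟨hl, ?_⟩, ?_⟩
        · by_contra! hall
          have huwl : Btw T u w l := by
            by_contra hno
            obtain ⟨d, hd, hud, hld⟩ := (not_btw_iff hT).1 hno
            rcases huN with huC | ⟨s, hs, hsu⟩
            · exact hno (hall u huC)
            · have hsd : s ∈ branch T w d := by
                by_contra hsd
                exact hCw s hs (branch_boundary hT hd hsu.symm hud hsd).2
              exact not_btw_of_mem hT hsd hld (hall s hs)
          have humw : Btw T u m w := by
            by_contra hno
            have h1 : Btw T w m a := (hma.or hT w).resolve_left hno
            have h2 : Btw T w m b := (hmb.or hT w).resolve_left hno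
            have h3 : w = m := by
              refine dist_eq_zero hT ?_
              unfold Btw at h1 h2 hm hawb
              rw [T.dist_comm (u := a) (v := m)] at hm
              rw [T.dist_comm (u := a) (v := w)] at hawb
              omega
            subst h3
            exact hno (by simp [Btw])
          exact hul (humw.trans hT huwl)
        · rintro (rfl | rfl)
          · exact hul hma
          · exact hul hmb

lemma exists_two_leaves_of_major [Finite V] (hT : T.IsTree) {o p : V} (h : T.Adj o p)
    (hp : Major T p) : ∃ a a', a ≠ a' ∧ Leaf T a ∧ Leaf T a' ∧ a ∈ branch T o p ∧
      a' ∈ branch T o p := by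
  obtain ⟨c, hc, hco, -⟩ := exists_third (p := o) (q := o) hp
  obtain ⟨d, hd, hdo, hdc⟩ := exists_third (p := o) (q := c) hp
  have key : ∀ c, T.Adj p c → c ≠ o → T.dist o c = 2 ∧ ∀ a, Btw T o c a → a ∈ branch T o p := by
    intro c hc hco
    have hcb := branch_subset hT h hc hco (mem_branch_self hc)
    have h1 : T.dist c o = T.dist c p + 1 := hcb
    rw [dist_adj hc.symm, T.dist_comm] at h1
    refine ⟨h1, fun a ha => ?_⟩
    have h2 := dist_adj_le hT hc a
    have h3 := dist_adj_le hT h a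
    unfold Btw at ha
    rw [T.dist_comm (u := c), T.dist_comm (u := o) (v := a)] at ha
    simp only [branch, Set.mem_ofPred_eq]
    omega
  obtain ⟨a, ha, hca⟩ := exists_leaf_beyond hT o c
  obtain ⟨a', ha', hda⟩ := exists_leaf_beyond hT o d
  obtain ⟨h1, h2⟩ := key c hc hco
  obtain ⟨h3, h4⟩ := key d hd hdo
  refine ⟨a, a', ?_, ha, ha', h2 a hca, h4 a' hda⟩
  rintro rfl
  exact hdc (btw_unique hT hda hca (h3.trans h1.symm))

lemma not_btw_of_notMem (hT : T.IsTree) {o s x y m : V} (h : T.Adj o s) (hm : m ∈ branch T o s)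
    (hx : x ∉ branch T o s) (hy : y ∉ branch T o s) : ¬ Btw T x m y := by
  have h1 := dist_across hT h hm hx
  have h2 := dist_across hT h hm hy
  have h3 := hT.connected.dist_triangle (u := x) (v := o) (w := y)
  unfold Btw
  rw [T.dist_comm (u := x) (v := m), h1, h2]
  rw [T.dist_comm (u := x) (v := o)] at h3
  omega

lemma capt_two_univ [Finite V] (hT : T.IsTree) {o p q r : V} (hpq : p ≠ q) (hpr : p ≠ r)
    (hqr : q ≠ r) (hp : T.Adj o p) (hq : T.Adj o q) (hr : T.Adj o r) (hpm : Major T p)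
    (hqm : Major T q) (hrm : Major T r) : capt T 2 (Nat.card V / 2 - 3) Set.univ := by
  obtain ⟨a, a', haa, ha, ha', hap, hap'⟩ := exists_two_leaves_of_major hT hp hpm
  obtain ⟨b, b', hbb, hb, hb', hbq, hbq'⟩ := exists_two_leaves_of_major hT hq hqm
  obtain ⟨c, c', hcc, hc, hc', hcr, hcr'⟩ := exists_two_leaves_of_major hT hr hrm
  have ne_of : ∀ {s t x y : V}, T.Adj o s → T.Adj o t → s ≠ t → x ∈ branch T o s →
      y ∈ branch T o t → x ≠ y := by
    rintro s t x _ hs ht hst hx hy rfl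
    exact branch_disjoint hT hs ht hst hx hy
  have four : ∀ {w x y z : V}, w ≠ x → w ≠ y → w ≠ z → x ≠ y → x ≠ z → y ≠ z →
      ({w, x, y, z} : Set V).ncard = 4 := by
    intro w x y z h1 h2 h3 h4 h5 h6
    rw [Set.ncard_insert_of_notMem (by simp [h1, h2, h3]) (Set.toFinite _),
      Set.ncard_insert_of_notMem (by simp [h4, h5]) (Set.toFinite _), Set.ncard_pair h6]
  have hcard : {l | Leaf T l}.ncard + 4 ≤ Nat.card V := by
    have hmaj : ∀ v, Major T v → ¬ Leaf T v := by
      rintro v ⟨x, y, z, hxy, -, -, hx, hy, -⟩ hl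
      exact hxy (hl x y hx hy)
    have h4 := four hp.ne hq.ne hr.ne hpq hpr hqr
    have hdisj : Disjoint {l | Leaf T l} {o, p, q, r} := by
      rw [Set.disjoint_left]
      rintro l hl (rfl | rfl | rfl | rfl)
      · exact hpq (hl p q hp hq)
      · exact hmaj _ hpm hl
      · exact hmaj _ hqm hl
      · exact hmaj _ hrm hl
    rw [← h4, ← Set.ncard_union_eq hdisj (Set.toFinite _) (Set.toFinite _), ← Set.ncard_univ]
    exact Set.ncard_le_ncard (Set.subset_univ _) (Set.toFinite _)
  have hmany : 4 ≤ {l | Leaf T l}.ncard := by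
    rw [← four haa (ne_of hp hq hpq hap hbq) (ne_of hp hr hpr hap hcr)
      (ne_of hp hq hpq hap' hbq) (ne_of hp hr hpr hap' hcr) (ne_of hq hr hqr hbq hcr)]
    refine Set.ncard_le_ncard ?_ (Set.toFinite _)
    rintro l (rfl | rfl | rfl | rfl) <;> assumption
  refine capt_mono_time (t := ({l | Leaf T l}.ncard - 4) / 2 + 1) (by omega) ?_
  refine capt_two_of_pair (a := a) (b := b) fun x _ => ?_
  obtain ⟨m, δ, hm, hu⟩ := exists_center hT a b x Set.univ
  refine capt_two_of_leavesBeyond hT _ δ m _ (fun u h => (hu u h.1 h.2.1 h.2.2).1) ?_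
  have hex : ∀ l ∈ leavesBeyond T m {u ∈ Set.univ | T.dist u a = T.dist x a ∧
      T.dist u b = T.dist x b}, l ≠ a ∧ l ≠ b ∧ Btw T a m l ∧ Btw T b m l := by
    rintro l ⟨-, u, ⟨hu0, hua, hub⟩, hul⟩
    obtain ⟨-, hma, hmb⟩ := hu u hu0 hua hub
    refine ⟨?_, ?_, ((hma.or hT l).resolve_left hul).symm, ((hmb.or hT l).resolve_left hul).symm⟩
    · rintro rfl
      exact hul hma
    · rintro rfl
      exact hul hmb
  have hfin : ∀ y z, Leaf T y → Leaf T z → a ≠ y → a ≠ z → b ≠ y → b ≠ z → y ≠ z →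
      (¬ Btw T a m y ∨ ¬ Btw T b m y) → (¬ Btw T a m z ∨ ¬ Btw T b m z) →
      (leavesBeyond T m {u ∈ Set.univ | T.dist u a = T.dist x a ∧
        T.dist u b = T.dist x b}).ncard ≤ 2 * (({l | Leaf T l}.ncard - 4) / 2) + 1 := by
    intro y z hy hz hay haz hby hbz hyz hym hzm
    have h1 := Set.ncard_sdiff_add_ncard_of_subset (s := {a, b, y, z}) (t := {l | Leaf T l})
      (by rintro l (rfl | rfl | rfl | rfl) <;> assumption) (Set.toFinite _)
    rw [four (ne_of hp hq hpq hap hbq) hay haz hby hbz hyz] at h1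
    refine (Set.ncard_le_ncard (t := {l | Leaf T l} \ {a, b, y, z}) ?_ (Set.toFinite _)).trans
      (by omega)
    intro l hl
    obtain ⟨h2, h3, h4, h5⟩ := hex l hl
    refine ⟨hl.1, ?_⟩
    rintro (rfl | rfl | rfl | rfl)
    · exact h2 rfl
    · exact h3 rfl
    · exact hym.elim (fun h => h h4) (fun h => h h5)
    · exact hzm.elim (fun h => h h4) (fun h => h h5)
  by_cases hmo : m = o
  · subst hmo
    exact hfin a' b' ha' hb' haa (ne_of hp hq hpq hap hbq') (ne_of hq hp hpq.symm hbq hap') hbb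
      (ne_of hp hq hpq hap' hbq') (Or.inl (not_btw_of_mem hT hap hap'))
      (Or.inr (not_btw_of_mem hT hbq hbq'))
  · obtain ⟨s, hs, hms⟩ := exists_branch hT hmo
    have hsr : r ≠ s := by
      rintro rfl
      exact not_btw_of_notMem hT hr hms (branch_disjoint hT hp hr hpr hap)
        (branch_disjoint hT hq hr hqr hbq) hm
    have hsep : ∀ y ∈ branch T o r, ¬ Btw T a m y ∨ ¬ Btw T b m y := by
      intro y hy
      have hys := branch_disjoint hT hr hs hsr hy
      by_cases hps : p = s
      · subst hps
        exact Or.inr (not_btw_of_notMem hT hs hms (branch_disjoint hT hq hs hpq.symm hbq) hys)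
      · exact Or.inl (not_btw_of_notMem hT hs hms (branch_disjoint hT hp hs hps hap) hys)
    exact hfin c c' hc hc' (ne_of hp hr hpr hap hcr) (ne_of hp hr hpr hap hcr')
      (ne_of hq hr hqr hbq hcr) (ne_of hq hr hqr hbq hcr') hcc (hsep c hcr) (hsep c' hcr')

lemma capt_one_univ [Finite V] (hT : T.IsTree) (hH : NoTripleMajor T) :
    ∃ t, capt T 1 t Set.univ := by
  by_cases hV : ∃ w x : V, x ≠ w
  · obtain ⟨w, x, hxw⟩ := hV
    obtain ⟨z, hz, hwx⟩ := exists_leaf_beyond hT w x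
    have hzw : w ≠ z := by
      rintro rfl
      unfold Btw at hwx
      simp only [SimpleGraph.dist_self, Nat.add_eq_zero_iff] at hwx
      exact hxw (dist_eq_zero hT hwx.2)
    obtain ⟨y, hy, -⟩ := exists_branch hT hzw
    refine (win_branch hT hH _ z y le_rfl hy).mono fun u _ => ?_
    by_cases huz : u = z
    · exact Or.inl huz
    · obtain ⟨y', hy', hu⟩ := exists_branch hT huz
      exact Or.inr (hz y' y hy' hy ▸ hu)
  · push Not at hV
    exact ⟨1, ∅, by simp, fun v _ => Or.inl fun x _ y _ => hV y x⟩

end LocGame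

/-- If `T` is a tree on `n` vertices with localization number `ζ(T) = 2`,
then `lcapt(T) ≤ ⌊n/2⌋ − 3`. -/
theorem stmt_3 {V : Type*} [Fintype V] (T : SimpleGraph V) (hT : T.IsTree)
    (hzeta : zeta T = 2) :
    lcapt T ≤ Fintype.card V / 2 - 3 := by
  have hno : ¬ ∃ t, capt T 1 t Set.univ := by
    intro h
    have : zeta T ≤ 1 := Nat.sInf_le h
    omega
  have htriple : ¬ LocGame.NoTripleMajor T := fun h => hno (LocGame.capt_one_univ hT h)
  unfold LocGame.NoTripleMajor at htriple
  push Not at htriple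
  obtain ⟨o, p, q, r, hpq, hpr, hqr, hp, hq, hr, hpm, hqm, hrm⟩ := htriple
  have hcapt := LocGame.capt_two_univ hT hpq hpr hqr hp hq hr hpm hqm hrm
  rw [Nat.card_eq_fintype_card] at hcapt
  rw [lcapt, hzeta]
  exact Nat.sInf_le hcapt
end

section
/- For every finite graph G on n vertices and any two colorings C_1 and C_2 of V(G), the game structure of G with respect to C_1, C_2 has at most n(n−1)/2 + 1 rows. -/
/-- `appearsBy G C i S`: the set `S` appears in one of the rows `1, …, i` of the game
structure of `G` with respect to the family of colorings `C`.  Row 1 consists of all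
singletons, and a nonempty set appears by row `i + 2` if it appears by row `i + 1`, or
there is a coloring `C j` all of whose color classes on `N[S]` appear by row `i + 1`. -/
def appearsBy {V : Type*} {ι : Type*} {α : ι → Type*} (G : SimpleGraph V)
    (C : ∀ i : ι, V → α i) : ℕ → Set V → Prop
  | 0, _ => False
  | 1, S => ∃ v, S = {v}
  | i + 2, S => appearsBy G C (i + 1) S ∨
      (S.Nonempty ∧ ∃ j : ι, ∀ v ∈ closedNbhd G S,
        appearsBy G C (i + 1) {u ∈ closedNbhd G S | C j u = C j v})

/-- `S` lies in row `i` of the game structure: it appears by row `i` but not earlier. -/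
def inRow {V : Type*} {ι : Type*} {α : ι → Type*} (G : SimpleGraph V)
    (C : ∀ i : ι, V → α i) (i : ℕ) (S : Set V) : Prop :=
  appearsBy G C i S ∧ ¬ appearsBy G C (i - 1) S

/-- The number of rows of the game structure: the largest `i` whose row is nonempty. -/
noncomputable def numRows {V : Type*} {ι : Type*} {α : ι → Type*} (G : SimpleGraph V)
    (C : ∀ i : ι, V → α i) : ℕ :=
  sSup {i | ∃ S : Set V, inRow G C i S}

section GameStructure

variable {V : Type*} {ι : Type*} {γ : Type*} {G : SimpleGraph V} {C : ι → V → γ}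

theorem closedNbhd_mono {S T : Set V} (h : S ⊆ T) : closedNbhd G S ⊆ closedNbhd G T := by
  rintro v (hv | ⟨s, hs, hsv⟩)
  · exact Or.inl (h hv)
  · exact Or.inr ⟨s, h hs, hsv⟩

theorem appearsBy_succ {i : ℕ} {S : Set V} (h : appearsBy G C i S) :
    appearsBy G C (i + 1) S := by
  cases i with
  | zero => exact h.elim
  | succ i => exact Or.inl h

theorem appearsBy_mono {i k : ℕ} (hik : i ≤ k) {S : Set V} (h : appearsBy G C i S) :
    appearsBy G C k S := by
  induction hik with
  | refl => exact h
  | step _ ih => exact appearsBy_succ ih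

theorem appearsBy_subset {i : ℕ} {S T : Set V} (h : appearsBy G C i S)
    (hTS : T ⊆ S) (hT : T.Nonempty) : appearsBy G C i T := by
  induction i generalizing S T with
  | zero => exact h.elim
  | succ i ih =>
    cases i with
    | zero =>
      obtain ⟨v, rfl⟩ := h
      exact ⟨v, hT.subset_singleton_iff.mp hTS⟩
    | succ i =>
      rcases h with h | ⟨_, j, hj⟩
      · exact Or.inl (ih h hTS hT)
      · refine Or.inr ⟨hT, j, fun v hv => ?_⟩
        exact ih (hj v (closedNbhd_mono hTS hv))
          (fun u hu => ⟨closedNbhd_mono hTS hu.1, hu.2⟩) ⟨v, hv, rfl⟩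

/-- A coloring that is constant on a nontrivial set is never the one needed to reach it. -/
theorem exists_other_coloring_of_appearsBy {i : ℕ} {S : Set V} {j₀ : ι} (hS : S.Nontrivial)
    (hc : ∀ u ∈ S, ∀ v ∈ S, C j₀ u = C j₀ v) (h : appearsBy G C (i + 1) S) :
    ∃ j, j ≠ j₀ ∧ ∀ v ∈ closedNbhd G S,
      appearsBy G C i {u ∈ closedNbhd G S | C j u = C j v} := by
  induction i with
  | zero =>
    obtain ⟨v, rfl⟩ := h
    exact absurd hS Set.not_nontrivial_singleton
  | succ i ih =>
    have lower : appearsBy G C (i + 1) S → ∃ j, j ≠ j₀ ∧ ∀ v ∈ closedNbhd G S,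
        appearsBy G C (i + 1) {u ∈ closedNbhd G S | C j u = C j v} := fun h' =>
      let ⟨j, hj, hall⟩ := ih h'
      ⟨j, hj, fun v hv => appearsBy_succ (hall v hv)⟩
    rcases h with h | ⟨hne, j, hj⟩
    · exact lower h
    · by_cases hjj : j = j₀
      · subst hjj
        obtain ⟨v, hv⟩ := hne
        exact lower (appearsBy_subset (hj v (Or.inl hv))
          (fun u hu => ⟨Or.inl hu, hc u hu v hv⟩) ⟨v, hv⟩)
      · exact ⟨j, hjj, hj⟩

theorem exists_pair_mem_closedNbhd {S : Set V} (hS : S.Nontrivial) {x y : V}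
    (hx : x ∈ closedNbhd G S) (hy : y ∈ closedNbhd G S) :
    ∃ u ∈ S, ∃ v ∈ S, u ≠ v ∧ x ∈ closedNbhd G {u, v} ∧ y ∈ closedNbhd G {u, v} := by
  have center : ∀ z ∈ closedNbhd G S, ∃ w ∈ S, z ∈ closedNbhd G {w} := by
    rintro z (hz | ⟨s, hs, hsz⟩)
    · exact ⟨z, hz, Or.inl rfl⟩
    · exact ⟨s, hs, Or.inr ⟨s, rfl, hsz⟩⟩
  obtain ⟨u, hu, hxu⟩ := center x hx
  obtain ⟨v, hv, hyv⟩ := center y hy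
  by_cases huv : u = v
  · subst huv
    obtain ⟨w, hw, hwu⟩ := hS.exists_ne u
    exact ⟨u, hu, w, hw, hwu.symm, closedNbhd_mono (by simp) hxu, closedNbhd_mono (by simp) hyv⟩
  · exact ⟨u, hu, v, hv, huv, closedNbhd_mono (by simp) hxu, closedNbhd_mono (by simp) hyv⟩

/-- Helly property: with two colorings, a monochromatic set appears as soon as all of its
pairs do. -/
theorem appearsBy_of_pairs {C : Fin 2 → V → γ} {i : ℕ} {S : Set V} {j₀ : Fin 2}
    (hS : S.Nonempty) (hc : ∀ u ∈ S, ∀ v ∈ S, C j₀ u = C j₀ v)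
    (hp : ∀ u ∈ S, ∀ v ∈ S, u ≠ v → appearsBy G C (i + 1) {u, v}) :
    appearsBy G C (i + 1) S := by
  rcases S.subsingleton_or_nontrivial with hsub | hnt
  · obtain ⟨v, hv⟩ := hS
    exact appearsBy_mono (i := 1) (by omega) ⟨v, hsub.eq_singleton_of_mem hv⟩
  induction i generalizing S j₀ with
  | zero =>
    obtain ⟨u, hu, v, hv, huv⟩ := hnt
    obtain ⟨w, hw⟩ := hp u hu v hv huv
    exact absurd hw (Set.nontrivial_pair huv).ne_singleton
  | succ i ih =>
    refine Or.inr ⟨hS, 1 - j₀, fun w hw => ?_⟩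
    set U := {u ∈ closedNbhd G S | C (1 - j₀) u = C (1 - j₀) w} with hU
    have hne : U.Nonempty := ⟨w, hw, rfl⟩
    rcases U.subsingleton_or_nontrivial with hsub | hUnt
    · exact appearsBy_mono (i := 1) (by omega) ⟨w, hsub.eq_singleton_of_mem ⟨hw, rfl⟩⟩
    refine ih (j₀ := 1 - j₀) hne (fun u hu v hv => hu.2.trans hv.2.symm) ?_ hUnt
    intro x hx y hy _
    obtain ⟨u, hu, v, hv, huv, hxN, hyN⟩ := exists_pair_mem_closedNbhd hnt hx.1 hy.1
    have hpc : ∀ a ∈ ({u, v} : Set V), ∀ b ∈ ({u, v} : Set V), C j₀ a = C j₀ b := fun a ha b hb =>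
      hc a (Set.pair_subset hu hv ha) b (Set.pair_subset hu hv hb)
    obtain ⟨j, hj, hall⟩ :=
      exists_other_coloring_of_appearsBy (Set.nontrivial_pair huv) hpc (hp u hu v hv huv)
    obtain rfl : j = 1 - j₀ := by omega
    exact appearsBy_subset (hall x hxN)
      (Set.pair_subset ⟨hxN, rfl⟩ ⟨hyN, hy.2.trans hx.2.symm⟩) ⟨x, by simp⟩

theorem appearsBy_nonempty {i : ℕ} {S : Set V} (h : appearsBy G C i S) : S.Nonempty := by
  induction i with
  | zero => exact h.elim
  | succ i ih =>
    cases i with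
    | zero =>
      obtain ⟨v, rfl⟩ := h
      exact Set.singleton_nonempty v
    | succ i =>
      rcases h with h | h
      · exact ih h
      · exact h.1

theorem exists_pair_inRow {C : Fin 2 → V → γ} {i : ℕ} {S : Set V} {j : Fin 2}
    (hc : ∀ u ∈ S, ∀ v ∈ S, C j u = C j v) (h : inRow G C (i + 2) S) :
    ∃ u ∈ S, ∃ v ∈ S, u ≠ v ∧ inRow G C (i + 2) {u, v} := by
  by_contra! hcon
  refine h.2 (appearsBy_of_pairs (appearsBy_nonempty h.1) hc fun u hu v hv huv => ?_)
  by_contra hn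
  exact hcon u hu v hv huv ⟨appearsBy_subset h.1 (Set.pair_subset hu hv) ⟨u, by simp⟩, hn⟩

theorem exists_monochromatic_inRow_pred {i : ℕ} {S : Set V} (h : inRow G C (i + 3) S) :
    ∃ T j, (∀ u ∈ T, ∀ v ∈ T, C j u = C j v) ∧ inRow G C (i + 2) T := by
  obtain ⟨h | ⟨hne, j, hj⟩, hn⟩ := h
  · exact absurd h hn
  by_contra! hcon
  refine hn (Or.inr ⟨hne, j, fun v hv => ?_⟩)
  by_contra hv'
  exact hcon _ j (fun a ha b hb => ha.2.trans hb.2.symm) ⟨hj v hv, hv'⟩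

theorem exists_monochromatic_inRow {i k : ℕ} (hik : i < k) {S : Set V}
    (h : inRow G C (k + 2) S) :
    ∃ T j, (∀ u ∈ T, ∀ v ∈ T, C j u = C j v) ∧ inRow G C (i + 2) T := by
  induction k generalizing S with
  | zero => omega
  | succ k ih =>
    obtain ⟨T, j, hc, hT⟩ := exists_monochromatic_inRow_pred h
    rcases Nat.lt_succ_iff_lt_or_eq.mp hik with hlt | rfl
    · exact ih hlt hT
    · exact ⟨T, j, hc, hT⟩

theorem exists_constant_of_forall_pair {C : Fin 2 → V → γ}
    (h : ∀ u v, ∃ j, C j u = C j v) : ∃ j, ∀ u v, C j u = C j v := by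
  simp only [Fin.exists_fin_two] at h ⊢
  by_contra! hcon
  obtain ⟨⟨a, b, hab⟩, c, d, hcd⟩ := hcon
  have := h a b
  have := h c d
  have := h a c
  have := h a d
  have := h b c
  have := h b d
  grind

theorem inRow_le_card {C : Fin 2 → V → γ} [Fintype V] {i : ℕ} {S : Set V}
    (h : inRow G C (i + 2) S) : i + 1 ≤ (Fintype.card V).choose 2 := by
  classical
  have hrow : ∀ k : ℕ, ∃ p : Finset V, k < i →
      p.card = 2 ∧ inRow G C (k + 2) (p : Set V) ∧
        ∃ j, ∀ u ∈ p, ∀ v ∈ p, C j u = C j v := by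
    intro k
    by_cases hk : k < i
    · obtain ⟨T, j, hc, hT⟩ := exists_monochromatic_inRow hk h
      obtain ⟨u, hu, v, hv, huv, hr⟩ := exists_pair_inRow hc hT
      refine ⟨{u, v}, fun _ => ⟨Finset.card_pair huv, by simpa using hr, j, ?_⟩⟩
      have hsub := Set.pair_subset hu hv
      intro a ha b hb
      exact hc a (hsub (by simpa using ha)) b (hsub (by simpa using hb))
    · exact ⟨∅, fun hk' => absurd hk' hk⟩
  choose f hf using hrow
  have hlast : ∃ p : Finset V, p.card = 2 ∧ ∀ k < i, f k ≠ p := by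
    by_contra! hcon
    have hpair : ∀ u v : V, u ≠ v → ∃ k < i, f k = {u, v} := fun u v huv =>
      hcon {u, v} (Finset.card_pair huv)
    obtain ⟨j, hj⟩ := exists_constant_of_forall_pair (C := C) fun u v => by
      by_cases huv : u = v
      · exact ⟨0, by rw [huv]⟩
      · obtain ⟨k, hk, hfk⟩ := hpair u v huv
        obtain ⟨j, hj⟩ := (hf k hk).2.2
        exact ⟨j, hj u (by simp [hfk]) v (by simp [hfk])⟩
    obtain ⟨u, _, v, _, huv, hr⟩ := exists_pair_inRow (fun u _ v _ => hj u v) h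
    obtain ⟨k, hk, hfk⟩ := hpair u v huv
    have hk' := (hf k hk).2.1.1
    rw [hfk, Finset.coe_pair] at hk'
    exact hr.2 (appearsBy_mono (by omega) hk')
  have hne : ∀ k l, k < l → l < i → f k ≠ f l := by
    intro k l hkl hl heq
    have hk' := (hf k (hkl.trans hl)).2.1.1
    rw [heq] at hk'
    exact (hf l hl).2.1.2 (appearsBy_mono (by omega) hk')
  obtain ⟨p, hp, hpf⟩ := hlast
  have hinj : Set.InjOn f (Finset.range i) := by
    intro k hk l hl heq
    simp only [Finset.coe_range, Set.mem_Iio] at hk hl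
    rcases lt_trichotomy k l with hkl | hkl | hkl
    · exact absurd heq (hne k l hkl hl)
    · exact hkl
    · exact absurd heq.symm (hne l k hkl hk)
  have hnotMem : p ∉ (Finset.range i).image f := by simpa using hpf
  calc i + 1 = (insert p ((Finset.range i).image f)).card := by
        rw [Finset.card_insert_of_notMem hnotMem, Finset.card_image_of_injOn hinj,
          Finset.card_range]
    _ ≤ (Finset.powersetCard 2 (Finset.univ : Finset V)).card := by
        refine Finset.card_le_card fun q hq => ?_
        simp only [Finset.mem_insert, Finset.mem_image, Finset.mem_range] at hq
        rcases hq with rfl | ⟨k, hk, rfl⟩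
        · simp [hp]
        · simp [(hf k hk).1]
    _ = (Fintype.card V).choose 2 := by rw [Finset.card_powersetCard, Finset.card_univ]

end GameStructure

/-- For every finite graph `G` on `n` vertices and any two colorings `C₁`, `C₂` of
`V(G)`, the game structure of `G` with respect to `C₁, C₂` has at most
`n(n−1)/2 + 1` rows. -/
theorem stmt_8 {V : Type*} {α β : Type*} [Fintype V] (G : SimpleGraph V)
    (C₁ : V → α) (C₂ : V → β) :
    numRows G (![fun v => Sum.inl (C₁ v), fun v => Sum.inr (C₂ v)] :
        Fin 2 → V → α ⊕ β) ≤
      Fintype.card V * (Fintype.card V - 1) / 2 + 1 := by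
  refine csSup_le' ?_
  rintro i ⟨S, hS⟩
  rw [← Nat.choose_two_right]
  match i, hS with
  | 0, _ => omega
  | 1, _ => omega
  | i + 2, hS => exact Nat.succ_le_succ (inRow_le_card hS)
end
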